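/- Let A be an irreducible k×k matrix with entries in {0,1}. Then for every real number h with 0 ≤ h ≤ h_top(σ, Σ_A), there exists an ergodic σ-invariant Borel probability measure μ on Σ_A such that h_μ(σ) = h. -/

import Mathlib

open MeasureTheory Real Filter Set

/-- The shift map on the full shift `ℤ → S`. -/
def shiftMap {S : Type*} : (ℤ → S) → (ℤ → S) := fun x i => x (i + 1)

/-- The subshift of finite type determined by the 0-1 matrix `A : S → S → ℕ`. -/
def SFT {S : Type*} (A : S → S → ℕ) : Set (ℤ → S) :=
  {x | ∀ i : ℤ, A (x i) (x (i + 1)) = 1}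

/-- `w : Fin n → S` is an admissible word for the 0-1 matrix `A`. -/
def IsAdmissible {S : Type*} (A : S → S → ℕ) {n : ℕ} (w : Fin n → S) : Prop :=
  ∀ (i : ℕ) (h : i + 1 < n), A (w ⟨i, Nat.lt_of_succ_lt h⟩) (w ⟨i + 1, h⟩) = 1

/-- The shift map restricted to the SFT determined by `A`. -/
def restrictShift {S : Type*} (A : S → S → ℕ) (x : ↥(SFT A)) : ↥(SFT A) :=
  ⟨shiftMap x.1, fun i => x.2 (i + 1)⟩

open Classical in
/-- The `n`-block recoding matrix `A_n`, indexed by admissible words of length `n`: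
`(b,b')`-entry is 1 iff the last `n-1` letters of `b` coincide with the first `n-1`
letters of `b'`. -/
noncomputable def blockMatrix {S : Type*} (A : S → S → ℕ) (n : ℕ) :
    {w : Fin n → S // IsAdmissible A w} → {w : Fin n → S // IsAdmissible A w} → ℕ :=
  fun b b' =>
    if ∀ (p : ℕ) (h : p + 1 < n), b.1 ⟨p + 1, h⟩ = b'.1 ⟨p, Nat.lt_of_succ_lt h⟩ then 1 else 0

open Classical in
/-- `m`-th power of the matrix `A : S → S → ℕ`. -/
noncomputable def matPow {S : Type*} [Fintype S] (A : S → S → ℕ) : ℕ → S → S → ℕ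
  | 0 => fun i j => if i = j then 1 else 0
  | (m + 1) => fun i j => ∑ r : S, matPow A m i r * A r j

/-- A nonnegative matrix is irreducible if for every `(i,j)` some power has positive
`(i,j)`-entry. -/
def IrreducibleMat {S : Type*} [Fintype S] (A : S → S → ℕ) : Prop :=
  ∀ i j : S, ∃ m : ℕ, 1 ≤ m ∧ 0 < matPow A m i j

noncomputable instance wordsFintype {S : Type*} [Fintype S] (A : S → S → ℕ) (n : ℕ) :
    Fintype {w : Fin n → S // IsAdmissible A w} := Fintype.ofFinite _

/-- Shannon entropy of the partition of the full shift into cylinders of length `n`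
(based at coordinates `0, …, n-1`). -/
noncomputable def blockH {k : ℕ} (μ : Measure (ℤ → Fin k)) (n : ℕ) : ℝ :=
  ∑ w : Fin n → Fin k,
    Real.negMulLog (μ {x | ∀ p : Fin n, x ((p : ℕ) : ℤ) = w p}).toReal

/-- The measure-theoretic (Kolmogorov–Sinai) entropy of a shift-invariant measure `μ`
on the full shift: since the coordinate partition is generating and `blockH μ` is
subadditive, it equals `inf_{n ≥ 1} blockH μ n / n`. -/
noncomputable def mEntropy {k : ℕ} (μ : Measure (ℤ → Fin k)) : ℝ :=
  ⨅ n : ℕ, blockH μ (n + 1) / (n + 1)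

/-- The number of admissible words of length `n` for `A`. -/
noncomputable def wordCount {k : ℕ} (A : Fin k → Fin k → ℕ) (n : ℕ) : ℕ :=
  Nat.card {w : Fin n → Fin k // IsAdmissible A w}

/-- The topological entropy of the SFT determined by an irreducible matrix `A`:
the exponential growth rate of the number of admissible words, which by
subadditivity equals `inf_{n ≥ 1} (log wordCount n) / n`. -/
noncomputable def topEnt {k : ℕ} (A : Fin k → Fin k → ℕ) : ℝ :=
  ⨅ n : ℕ, Real.log (wordCount A (n + 1)) / (n + 1)

/-- `μ` is a `σ`-invariant Borel probability measure carried by the SFT `Σ_A`. -/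
def InvProbOn {k : ℕ} (A : Fin k → Fin k → ℕ) (μ : Measure (ℤ → Fin k)) : Prop :=
  IsProbabilityMeasure μ ∧ MeasurePreserving shiftMap μ μ ∧ μ (SFT A) = 1

open scoped Matrix

lemma exists_pos_eigenvector {k : ℕ} (hk : 1 ≤ k) (M : Matrix (Fin k) (Fin k) ℝ)
    (hM : ∀ i j, 0 ≤ M i j) (hirr : ∀ i j, ∃ m : ℕ, 1 ≤ m ∧ 0 < (M ^ m) i j) :
    ∃ (c : ℝ) (r : Fin k → ℝ), 0 < c ∧ (∀ i, 0 < r i) ∧ M *ᵥ r = c • r := by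
  classical
  have : Nonempty (Fin k) := ⟨⟨0, hk⟩⟩
  have hpow : ∀ (m : ℕ) i j, 0 ≤ (M ^ m) i j := by
    intro m
    induction m with
    | zero => intro i j; rw [pow_zero, Matrix.one_apply]; split_ifs <;> norm_num
    | succ m ih =>
      intro i j
      rw [pow_succ, Matrix.mul_apply]
      exact Finset.sum_nonneg fun l _ => mul_nonneg (ih i l) (hM l j)
  choose e he1 he using hirr
  obtain ⟨N, hN⟩ : ∃ N, ∀ i j, e i j < N := by
    refine ⟨∑ i, ∑ j, e i j + 1, fun i j => Nat.lt_succ_of_le ?_⟩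
    exact (Finset.single_le_sum (f := fun j => e i j) (fun _ _ => Nat.zero_le _)
      (Finset.mem_univ j)).trans (Finset.single_le_sum (f := fun i => ∑ j, e i j)
        (fun _ _ => Nat.zero_le _) (Finset.mem_univ i))
  set B : Matrix (Fin k) (Fin k) ℝ := ∑ m ∈ Finset.range N, M ^ m with hB
  have hBpos : ∀ i j, 0 < B i j := by
    intro i j
    rw [hB, Matrix.sum_apply]
    exact Finset.sum_pos' (fun m _ => hpow m i j) ⟨e i j, Finset.mem_range.2 (hN i j), he i j⟩
  have hBM : B * M = M * B := by
    rw [hB, Finset.sum_mul, Finset.mul_sum]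
    exact Finset.sum_congr rfl fun m _ => by rw [← pow_succ, ← pow_succ']
  have hBvec : ∀ v : Fin k → ℝ, (∀ i, 0 ≤ v i) → v ≠ 0 → ∀ i, 0 < (B *ᵥ v) i := by
    intro v hv hv0 i
    obtain ⟨j, hj⟩ := Function.ne_iff.1 hv0
    exact Finset.sum_pos' (fun l _ => mul_nonneg (hBpos i l).le (hv l))
      ⟨j, Finset.mem_univ j, mul_pos (hBpos i j) (lt_of_le_of_ne (hv j) (Ne.symm hj))⟩
  set K : ℝ := ∑ i, ∑ j, M i j with hK
  have bound : ∀ (t : ℝ) (x : Fin k → ℝ), x ∈ stdSimplex ℝ (Fin k) →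
      (∀ i, t * x i ≤ (M *ᵥ x) i) → t ≤ K := by
    intro t x hx h
    calc t = ∑ i, t * x i := by rw [← Finset.mul_sum, hx.2, mul_one]
      _ ≤ ∑ i, (M *ᵥ x) i := Finset.sum_le_sum fun i _ => h i
      _ ≤ K := by
        simp only [hK, Matrix.mulVec, dotProduct]
        refine Finset.sum_le_sum fun i _ => Finset.sum_le_sum fun j _ => ?_
        have : x j ≤ 1 := by
          rw [← hx.2]
          exact Finset.single_le_sum (f := x) (fun l _ => hx.1 l) (Finset.mem_univ j)
        exact mul_le_of_le_one_right (hM i j) this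
  let T : Set (ℝ × (Fin k → ℝ)) := (Icc 0 K ×ˢ stdSimplex ℝ (Fin k)) ∩
    {p | ∀ i, p.1 * p.2 i ≤ (M *ᵥ p.2) i}
  have hTc : IsCompact T := by
    refine (isCompact_Icc.prod (isCompact_stdSimplex ℝ (Fin k))).inter_right ?_
    have : {p : ℝ × (Fin k → ℝ) | ∀ i, p.1 * p.2 i ≤ (M *ᵥ p.2) i} =
        ⋂ i, {p | p.1 * p.2 i ≤ ∑ j, M i j * p.2 j} := by
      ext p; simp [Matrix.mulVec, dotProduct]
    rw [this]
    exact isClosed_iInter fun i => isClosed_le (by fun_prop) (by fun_prop)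
  have hK0 : 0 ≤ K := Finset.sum_nonneg fun i _ => Finset.sum_nonneg fun j _ => hM i j
  have hTne : T.Nonempty := by
    refine ⟨(0, Pi.single ⟨0, hk⟩ 1), ⟨⟨le_rfl, hK0⟩, single_mem_stdSimplex ℝ _⟩, fun i => ?_⟩
    simp only [zero_mul, Matrix.mulVec, dotProduct]
    exact Finset.sum_nonneg fun j _ =>
      mul_nonneg (hM i j) ((single_mem_stdSimplex ℝ (⟨0, hk⟩ : Fin k)).1 j)
  obtain ⟨⟨t, x⟩, ⟨⟨ht, hx⟩, hle⟩, hmax⟩ := hTc.exists_isMaxOn hTne continuous_fst.continuousOn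
  simp only [mem_ofPred_eq] at hle hx ht
  have hx0 : x ≠ 0 := by
    rintro rfl
    have := hx.2
    simp at this
  have heig : M *ᵥ x = t • x := by
    by_contra hne
    set y := B *ᵥ x with hy
    have hypos : ∀ i, 0 < y i := hBvec x hx.1 hx0
    have hz : ∀ i, 0 < (M *ᵥ y) i - t * y i := by
      intro i
      have h1 := hBvec (M *ᵥ x - t • x) (fun i => by simpa using hle i)
        (sub_ne_zero.2 hne) i
      rwa [Matrix.mulVec_sub, Matrix.mulVec_mulVec, hBM, ← Matrix.mulVec_mulVec,
        Matrix.mulVec_smul] at h1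
    obtain ⟨i₀, hi₀⟩ := Finite.exists_min fun i => ((M *ᵥ y) i - t * y i) / y i
    set δ := ((M *ᵥ y) i₀ - t * y i₀) / y i₀ with hδ
    have hδ0 : 0 < δ := div_pos (hz i₀) (hypos i₀)
    set s := ∑ i, y i with hs
    have hs0 : 0 < s := Finset.sum_pos (fun i _ => hypos i) Finset.univ_nonempty
    have hmem : s⁻¹ • y ∈ stdSimplex ℝ (Fin k) := by
      refine ⟨fun i => mul_nonneg (inv_nonneg.2 hs0.le) (hypos i).le, ?_⟩
      simp only [Pi.smul_apply, smul_eq_mul, ← Finset.mul_sum]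
      exact inv_mul_cancel₀ hs0.ne'
    have hle' : ∀ i, (t + δ) * (s⁻¹ • y) i ≤ (M *ᵥ (s⁻¹ • y)) i := by
      intro i
      have h1 := (le_div_iff₀ (hypos i)).1 (hi₀ i)
      rw [Matrix.mulVec_smul]
      simp only [Pi.smul_apply, smul_eq_mul]
      rw [mul_left_comm]
      refine mul_le_mul_of_nonneg_left ?_ (inv_nonneg.2 hs0.le)
      linarith
    have h2 := hmax (show (t + δ, s⁻¹ • y) ∈ T from
      ⟨⟨⟨by linarith [ht.1], bound _ _ hmem hle'⟩, hmem⟩, hle'⟩)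
    simp only [mem_ofPred_eq] at h2
    linarith
  have hpowx : ∀ m : ℕ, (M ^ m) *ᵥ x = t ^ m • x := by
    intro m
    induction m with
    | zero => simp
    | succ m ih => rw [pow_succ, ← Matrix.mulVec_mulVec, heig, Matrix.mulVec_smul, ih, smul_smul,
        pow_succ']
  have hxpos : ∀ i, 0 < x i := by
    intro i
    refine lt_of_le_of_ne (hx.1 i) fun h0 => ?_
    have h1 := hBvec x hx.1 hx0 i
    rw [hB, Matrix.sum_mulVec, Finset.sum_apply] at h1
    simp [hpowx, ← h0] at h1
  refine ⟨t, x, lt_of_le_of_ne ht.1 fun h0 => ?_, hxpos, heig⟩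
  let i : Fin k := ⟨0, hk⟩
  have h1 := congrFun (hpowx (e i i)) i
  rw [← h0, zero_pow (by have := he1 i i; omega)] at h1
  have h2 : 0 < ((M ^ e i i) *ᵥ x) i := by
    simp only [Matrix.mulVec, dotProduct]
    exact Finset.sum_pos' (fun l _ => mul_nonneg (hpow _ i l) (hxpos l).le)
      ⟨i, Finset.mem_univ i, mul_pos (he i i) (hxpos i)⟩
  simp at h1
  linarith

/-- The weight of a word for the initial vector `f` and the transition matrix `M`. -/
noncomputable def wordWeight {k : ℕ} (f : Fin k → ℝ) (M : Matrix (Fin k) (Fin k) ℝ) (n : ℕ)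
    (w : Fin (n + 1) → Fin k) : ℝ :=
  f (w 0) * ∏ i : Fin n, M (w i.castSucc) (w i.succ)

lemma wordWeight_snoc {k : ℕ} (f : Fin k → ℝ) (M : Matrix (Fin k) (Fin k) ℝ) (n : ℕ)
    (w : Fin (n + 1) → Fin k) (j : Fin k) :
    wordWeight f M (n + 1) (Fin.snoc (α := fun _ => Fin k) w j) =
      wordWeight f M n w * M (w (Fin.last n)) j := by
  have h0 : (Fin.snoc (α := fun _ => Fin k) w j : Fin (n + 2) → Fin k) 0 = w 0 := by
    rw [← Fin.castSucc_zero, Fin.snoc_castSucc]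
  simp only [wordWeight, Fin.prod_univ_castSucc, Fin.snoc_castSucc, Fin.succ_last, Fin.snoc_last,
    Fin.succ_castSucc, h0]
  ring

lemma sum_words_snoc {k : ℕ} (n : ℕ) (F : (Fin (n + 2) → Fin k) → ℝ) :
    ∑ w, F w = ∑ w : Fin (n + 1) → Fin k, ∑ j, F (Fin.snoc (α := fun _ => Fin k) w j) := by
  rw [← (Fin.snocEquiv fun _ : Fin (n + 2) => Fin k).sum_comp, Fintype.sum_prod_type,
    Finset.sum_comm]
  rfl

lemma sum_wordWeight_mul {k : ℕ} (f : Fin k → ℝ) (M : Matrix (Fin k) (Fin k) ℝ) (n : ℕ)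
    (F : Fin k → ℝ) :
    ∑ w, wordWeight f M n w * F (w (Fin.last n)) = f ⬝ᵥ ((M ^ n) *ᵥ F) := by
  induction n generalizing F with
  | zero =>
    rw [← (Equiv.funUnique (Fin 1) (Fin k)).symm.sum_comp]
    simp [wordWeight, dotProduct]
  | succ n ih =>
    rw [sum_words_snoc, pow_succ, ← Matrix.mulVec_mulVec, ← ih]
    refine Finset.sum_congr rfl fun w _ => ?_
    simp only [wordWeight_snoc, Fin.snoc_last, Matrix.mulVec, dotProduct, Finset.mul_sum, mul_assoc]

lemma wordWeight_one_eq {k : ℕ} (A : Fin k → Fin k → ℕ) (h01 : ∀ i j, A i j = 0 ∨ A i j = 1)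
    (n : ℕ) (w : Fin (n + 1) → Fin k) [Decidable (IsAdmissible A w)] :
    wordWeight (fun _ => 1) (Matrix.of fun i j => (A i j : ℝ)) n w =
      if IsAdmissible A w then 1 else 0 := by
  simp only [wordWeight, one_mul, Matrix.of_apply]
  split_ifs with h
  · refine Finset.prod_eq_one fun i _ => ?_
    have := h i (by omega)
    simp only [Fin.castSucc, Fin.succ, Fin.castAdd, Fin.castLE] at this ⊢
    exact_mod_cast this
  · simp only [IsAdmissible, not_forall] at h
    obtain ⟨i, hi, h⟩ := h
    refine Finset.prod_eq_zero (Finset.mem_univ (⟨i, by omega⟩ : Fin n)) ?_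
    exact_mod_cast (h01 _ _).resolve_right h

lemma topEnt_le_log {k : ℕ} (hk : 1 ≤ k) (A : Fin k → Fin k → ℕ)
    (h01 : ∀ i j, A i j = 0 ∨ A i j = 1) (c : ℝ) (hc : 0 < c) (r : Fin k → ℝ)
    (hr : ∀ i, 0 < r i) (heig : (Matrix.of fun i j => (A i j : ℝ)) *ᵥ r = c • r) :
    topEnt A ≤ Real.log c := by
  classical
  have : Nonempty (Fin k) := ⟨⟨0, hk⟩⟩
  set M : Matrix (Fin k) (Fin k) ℝ := Matrix.of fun i j => (A i j : ℝ) with hM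
  have hpow : ∀ m : ℕ, (M ^ m) *ᵥ r = c ^ m • r := by
    intro m
    induction m with
    | zero => simp
    | succ m ih => rw [pow_succ, ← Matrix.mulVec_mulVec, heig, Matrix.mulVec_smul, ih, smul_smul,
        pow_succ']
  set R := ∑ i, r i with hR
  have hR0 : 0 < R := Finset.sum_pos (fun i _ => hr i) Finset.univ_nonempty
  obtain ⟨i₀, hi₀⟩ := Finite.exists_min r
  have key : ∀ n, ∑ w : Fin (n + 1) → Fin k, (if IsAdmissible A w then r (w (Fin.last n)) else 0)
      = c ^ n * R := by
    intro n
    have := sum_wordWeight_mul (fun _ => 1) M n r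
    rw [hpow] at this
    simp only [hM, wordWeight_one_eq A h01, ite_mul, one_mul, zero_mul] at this
    rw [this, hR]
    simp [dotProduct, Finset.mul_sum]
  have hcard : ∀ n, (wordCount A (n + 1) : ℝ) =
      ∑ w : Fin (n + 1) → Fin k, (if IsAdmissible A w then 1 else 0) := by
    intro n
    rw [wordCount, Nat.card_eq_fintype_card, Fintype.card_subtype]
    simp
  have hup : ∀ n, (wordCount A (n + 1) : ℝ) ≤ R / r i₀ * c ^ n := by
    intro n
    rw [div_mul_eq_mul_div, le_div_iff₀ (hr i₀), mul_comm R, ← key, hcard, Finset.sum_mul]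
    refine Finset.sum_le_sum fun w _ => ?_
    split_ifs
    · rw [one_mul]; exact hi₀ _
    · simp
  have hpos : ∀ n, (0 : ℝ) < wordCount A (n + 1) := by
    intro n
    have h1 : c ^ n * R ≤ R * wordCount A (n + 1) := by
      rw [← key, hcard, Finset.mul_sum]
      refine Finset.sum_le_sum fun w _ => ?_
      split_ifs
      · rw [mul_one]
        exact Finset.single_le_sum (f := r) (fun i _ => (hr i).le) (Finset.mem_univ _)
      · simp
    have h2 : 0 < c ^ n * R := by positivity
    exact pos_of_mul_pos_right (h2.trans_le h1) hR0.le
  have hle : ∀ n : ℕ, topEnt A ≤ (Real.log (R / r i₀) - Real.log c) / (n + 1) + Real.log c := by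
    intro n
    have hb : BddBelow (Set.range fun n : ℕ => Real.log (wordCount A (n + 1)) / ((n : ℝ) + 1)) :=
      ⟨0, by rintro _ ⟨n, rfl⟩; exact div_nonneg (Real.log_natCast_nonneg _) (by positivity)⟩
    refine (ciInf_le hb n).trans ?_
    have h1 := Real.log_le_log (hpos n) (hup n)
    have : 0 < R / r i₀ := div_pos hR0 (hr i₀)
    rw [Real.log_mul this.ne' (by positivity), Real.log_pow] at h1
    have h3 : (0 : ℝ) < n + 1 := by positivity
    rw [div_add' _ _ _ h3.ne']
    refine div_le_div_of_nonneg_right ?_ h3.le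
    linarith
  have hlim : Tendsto (fun n : ℕ => (Real.log (R / r i₀) - Real.log c) / ((n : ℝ) + 1) + Real.log c)
      atTop (nhds (0 + Real.log c)) :=
    Tendsto.add_const _ (((tendsto_const_div_atTop_nhds_zero_nat
      (Real.log (R / r i₀) - Real.log c)).comp (tendsto_add_atTop_nat 1)).congr fun n => by simp)
  rw [zero_add] at hlim
  exact ge_of_tendsto' hlim hle

/-- The set of configurations agreeing with `z` on the window `[a, a + n]`. -/
def cyl {S : Type*} (z : ℤ → S) (a : ℤ) (n : ℕ) : Set (ℤ → S) :=
  {y | ∀ i : ℕ, i ≤ n → y (a + i) = z (a + i)}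

lemma mem_cyl_succ {S : Type*} (z y : ℤ → S) (a : ℤ) (n : ℕ) :
    y ∈ cyl z a (n + 1) ↔ y ∈ cyl z a n ∧ y (a + n + 1) = z (a + n + 1) := by
  constructor
  · intro h
    refine ⟨fun i hi => h i (by omega), ?_⟩
    have := h (n + 1) le_rfl
    push_cast at this
    rwa [add_assoc]
  · rintro ⟨h1, h2⟩ i hi
    rcases Nat.lt_or_ge n i with h | h
    · obtain rfl : i = n + 1 := by omega
      push_cast
      rwa [← add_assoc]
    · exact h1 i h

lemma exists_pmf_markov {S : Type*} (p : PMF S) (P : S → PMF S) (hst : p.bind P = p) (a : ℤ)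
    (N : ℕ) : ∃ ν : PMF (ℤ → S), ∀ (z : ℤ → S) (c : ℤ) (n : ℕ), a ≤ c → c + n ≤ a + N →
      ν.toOuterMeasure (cyl z c n) =
        p (z c) * ∏ i ∈ Finset.range n, P (z (c + i)) (z (c + i + 1)) := by
  classical
  induction N with
  | zero =>
    refine ⟨p.map fun i _ => i, fun z c n h1 h2 => ?_⟩
    obtain rfl : n = 0 := by omega
    rw [PMF.toOuterMeasure_map_apply]
    have : (fun (i : S) (_ : ℤ) => i) ⁻¹' cyl z c 0 = {z c} := by
      ext i
      simp [cyl]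
    rw [this, PMF.toOuterMeasure_apply_singleton]
    simp
  | succ N ih =>
    obtain ⟨ν, hν⟩ := ih
    obtain ⟨b, hb⟩ : ∃ b, b = a + N := ⟨_, rfl⟩
    have hmarg : ν.map (fun x => x b) = p := by
      ext i
      rw [← PMF.toOuterMeasure_apply_singleton, PMF.toOuterMeasure_map_apply]
      have := hν (fun _ => i) b 0 (by omega) (by simp [hb])
      simp only [Finset.range_zero, Finset.prod_empty, mul_one] at this
      rw [← this]
      congr 1
      ext x
      simp [cyl]
    let ext : (ℤ → S) → S → (ℤ → S) := fun x j i => if i ≤ b then x i else j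
    refine ⟨ν.bind fun x => (P (x b)).map (ext x), fun z c n h1 h2 => ?_⟩
    rw [PMF.toOuterMeasure_bind_apply]
    simp only [PMF.toOuterMeasure_map_apply]
    push_cast at h2
    rcases lt_or_ge b (c + n) with h | h
    · cases n with
      | zero =>
        obtain rfl : c = b + 1 := by push_cast at h; omega
        have hpre : ∀ x, ext x ⁻¹' cyl z (b + 1) 0 = {z (b + 1)} := by
          intro x; ext j; simp [cyl, ext]
        simp only [hpre, PMF.toOuterMeasure_apply_singleton]
        have h3 : ((ν.map fun x => x b).bind P) (z (b + 1)) = p (z (b + 1)) := by rw [hmarg, hst]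
        rw [PMF.bind_map, PMF.bind_apply] at h3
        simpa using h3
      | succ n =>
        obtain hbn : b = c + n := by push_cast at h; omega
        have hpre : ∀ x, ext x ⁻¹' cyl z c (n + 1) =
            if x ∈ cyl z c n then {z (b + 1)} else ∅ := by
          intro x
          have h4 : ∀ j, ext x j ∈ cyl z c n ↔ x ∈ cyl z c n := by
            intro j
            refine forall₂_congr fun i hi => ?_
            simp only [ext]
            rw [if_pos (by omega)]
          ext j
          rw [mem_preimage, mem_cyl_succ, h4, ← hbn]
          split_ifs with h5 <;> simp [h5, ext]
        rw [Finset.prod_range_succ, ← mul_assoc, ← hν z c n h1 (by omega),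
          PMF.toOuterMeasure_apply, ← ENNReal.tsum_mul_right]
        refine tsum_congr fun x => ?_
        rw [hpre]
        split_ifs with h5
        · have : x b = z b := by rw [hbn]; exact h5 n le_rfl
          rw [indicator_of_mem h5, PMF.toOuterMeasure_apply_singleton, this, ← hbn]
        · simp [h5]
    · have hpre : ∀ x, ext x ⁻¹' cyl z c n = if x ∈ cyl z c n then univ else ∅ := by
        intro x
        have h4 : ∀ j, ext x j ∈ cyl z c n ↔ x ∈ cyl z c n := by
          intro j
          refine forall₂_congr fun i hi => ?_
          simp only [ext]
          rw [if_pos (by omega)]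
        ext j
        rw [mem_preimage, h4]
        split_ifs with h5 <;> simp [h5]
      rw [← hν z c n h1 (by omega), PMF.toOuterMeasure_apply]
      refine tsum_congr fun x => ?_
      rw [hpre]
      split_ifs with h5
      · have : (P (x b)).toOuterMeasure univ = 1 := by
          rw [PMF.toOuterMeasure_apply_eq_one_iff]; exact subset_univ _
        rw [this, indicator_of_mem h5, mul_one]
      · simp [h5]

lemma isClopen_cyl {k : ℕ} (z : ℤ → Fin k) (a : ℤ) (n : ℕ) : IsClopen (cyl z a n) := by
  have : cyl z a n = ⋂ i ∈ Finset.range (n + 1), (fun y : ℤ → Fin k => y (a + (i : ℕ))) ⁻¹'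
      {z (a + (i : ℕ))} := by
    ext y; simp [cyl]
  rw [this]
  exact isClopen_biInter_finset fun i _ => (isClopen_discrete _).preimage (continuous_apply _)

lemma exists_measure_cyl {k : ℕ} (p : Fin k → ℝ) (P : Matrix (Fin k) (Fin k) ℝ)
    (hp : ∀ i, 0 ≤ p i) (hp1 : ∑ i, p i = 1) (hP : ∀ i j, 0 ≤ P i j)
    (hP1 : ∀ i, ∑ j, P i j = 1) (hst : ∀ j, ∑ i, p i * P i j = p j) :
    ∃ μ : Measure (ℤ → Fin k), IsProbabilityMeasure μ ∧ ∀ (z : ℤ → Fin k) (a : ℤ) (n : ℕ),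
      μ.real (cyl z a n) = p (z a) * ∏ i ∈ Finset.range n, P (z (a + i)) (z (a + i + 1)) := by
  let p' : PMF (Fin k) := PMF.ofFintype (fun i => ENNReal.ofReal (p i)) (by
    rw [← ENNReal.ofReal_sum_of_nonneg fun i _ => hp i, hp1, ENNReal.ofReal_one])
  let P' : Fin k → PMF (Fin k) := fun i => PMF.ofFintype (fun j => ENNReal.ofReal (P i j)) (by
    rw [← ENNReal.ofReal_sum_of_nonneg fun j _ => hP i j, hP1, ENNReal.ofReal_one])
  have hst' : p'.bind P' = p' := by
    ext j
    rw [PMF.bind_apply, tsum_fintype]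
    simp only [p', P', PMF.ofFintype_apply]
    rw [← hst j, ENNReal.ofReal_sum_of_nonneg fun i _ => mul_nonneg (hp i) (hP i j)]
    exact Finset.sum_congr rfl fun i _ => (ENNReal.ofReal_mul (hp i)).symm
  choose ν hν using fun N : ℕ => exists_pmf_markov p' P' hst' (-N) (2 * N)
  let μs : ℕ → ProbabilityMeasure (ℤ → Fin k) := fun N => ⟨(ν N).toMeasure, inferInstance⟩
  obtain ⟨μ, -, hμ⟩ := isCompact_univ.ultrafilter_le_nhds ((hyperfilter ℕ).map μs) (by simp)
  have hμ' : Tendsto μs (hyperfilter ℕ : Filter ℕ) (nhds μ) := hμ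
  refine ⟨μ, inferInstance, fun z a n => ?_⟩
  have h1 := ProbabilityMeasure.tendsto_measure_of_isClopen_of_tendsto hμ' (isClopen_cyl z a n)
  have h2 : ∀ᶠ N in (hyperfilter ℕ : Filter ℕ), ((μs N (cyl z a n) : NNReal) : ℝ) =
      p (z a) * ∏ i ∈ Finset.range n, P (z (a + i)) (z (a + i + 1)) := by
    refine Filter.Eventually.filter_mono Nat.hyperfilter_le_atTop ?_
    filter_upwards [eventually_ge_atTop (a.natAbs + n)] with N hN
    have h3 := hν N z a n (by omega) (by push_cast; omega)
    rw [ProbabilityMeasure.coeFn_def]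
    simp only [μs, ProbabilityMeasure.coe_mk]
    rw [PMF.toMeasure_apply_eq_toOuterMeasure_apply _ (isClopen_cyl z a n).isOpen.measurableSet, h3]
    simp only [p', P', PMF.ofFintype_apply]
    rw [← ENNReal.ofReal_prod_of_nonneg fun i _ => hP _ _, ← ENNReal.ofReal_mul (hp _)]
    exact ENNReal.toReal_ofReal (mul_nonneg (hp _) (Finset.prod_nonneg fun i _ => hP _ _))
  have h4 : Tendsto (fun N => ((μs N (cyl z a n) : NNReal) : ℝ)) (hyperfilter ℕ : Filter ℕ)
      (nhds ((μ (cyl z a n) : NNReal) : ℝ)) := (NNReal.tendsto_coe).2 h1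
  rw [← ProbabilityMeasure.measureReal_eq_coe_coeFn] at h4
  exact tendsto_nhds_unique h4 (tendsto_const_nhds.congr' (h2.mono fun _ h => h.symm))

lemma eq_of_harmonic {k : ℕ} (p : Fin k → ℝ) (P : Matrix (Fin k) (Fin k) ℝ)
    (hp : ∀ i, 0 ≤ p i) (hP : ∀ i j, 0 ≤ P i j)
    (hP1 : ∀ i, ∑ j, P i j = 1) (hst : ∀ j, ∑ i, p i * P i j = p j)
    (hconn : ∀ i j, 0 < p i → 0 < p j → Relation.ReflTransGen (fun a b => 0 < p a * P a b) i j)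
    (u : Fin k → ℝ) (hu : ∀ i, ∑ l, P i l * u l = u i) (i j : Fin k) (hi : 0 < p i)
    (hj : 0 < p j) : u i = u j := by
  have h0 : ∑ i, ∑ l, p i * P i l * (u i - u l) ^ 2 = 0 := by
    have e1 : ∑ i, ∑ l, p i * P i l * (u i) ^ 2 = ∑ i, p i * u i ^ 2 := by
      refine Finset.sum_congr rfl fun i _ => ?_
      rw [← Finset.sum_mul, ← Finset.mul_sum, hP1, mul_one]
    have e2 : ∑ i, ∑ l, p i * u i * (P i l * u l) = ∑ i, p i * u i ^ 2 := by
      refine Finset.sum_congr rfl fun i _ => ?_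
      rw [← Finset.mul_sum, hu]; ring
    have e3 : ∑ i, ∑ l, p i * P i l * (u l) ^ 2 = ∑ i, p i * u i ^ 2 := by
      rw [Finset.sum_comm]
      refine Finset.sum_congr rfl fun i _ => ?_
      rw [← Finset.sum_mul, hst]
    calc _ = ∑ i, ∑ l, (p i * P i l * (u i) ^ 2 + p i * P i l * (u l) ^ 2
          - 2 * (p i * u i * (P i l * u l))) := by
          refine Finset.sum_congr rfl fun i _ => Finset.sum_congr rfl fun l _ => by ring
      _ = 0 := by
          simp only [Finset.sum_sub_distrib, Finset.sum_add_distrib, ← Finset.mul_sum] at *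
          rw [e1, e2, e3]; ring
  have hnn : ∀ i l, 0 ≤ p i * P i l * (u i - u l) ^ 2 := fun i l =>
    mul_nonneg (mul_nonneg (hp i) (hP i l)) (sq_nonneg _)
  have hedge : ∀ a b, 0 < p a * P a b → u a = u b := by
    intro a b hab
    have h1 := (Finset.sum_eq_zero_iff_of_nonneg fun i _ =>
      Finset.sum_nonneg fun l _ => hnn i l).1 h0 a (Finset.mem_univ a)
    have h2 := (Finset.sum_eq_zero_iff_of_nonneg fun l _ => hnn a l).1 h1 b (Finset.mem_univ b)
    have h3 := (mul_eq_zero.1 h2).resolve_left hab.ne'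
    exact sub_eq_zero.1 (pow_eq_zero_iff (two_ne_zero) |>.1 h3)
  have hpath := hconn i j hi hj
  clear hj
  induction hpath with
  | refl => rfl
  | tail _ hbc ih => exact ih.trans (hedge _ _ hbc)

lemma exists_tendsto_cesaro {k : ℕ} (p : Fin k → ℝ) (P : Matrix (Fin k) (Fin k) ℝ)
    (hp : ∀ i, 0 ≤ p i) (hp1 : ∑ i, p i = 1) (hP : ∀ i j, 0 ≤ P i j)
    (hP1 : ∀ i, ∑ j, P i j = 1) (hst : ∀ j, ∑ i, p i * P i j = p j)
    (hconn : ∀ i j, 0 < p i → 0 < p j → Relation.ReflTransGen (fun a b => 0 < p a * P a b) i j) :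
    ∃ φ : ℕ → ℕ, StrictMono φ ∧ ∀ i j, 0 < p i →
      Tendsto (fun n => (φ n : ℝ)⁻¹ * ∑ g ∈ Finset.range (φ n), (P ^ (g + 1)) i j) atTop
        (nhds (p j)) := by
  have hpow0 : ∀ (m : ℕ) i j, 0 ≤ (P ^ m) i j := by
    intro m
    induction m with
    | zero => intro i j; rw [pow_zero, Matrix.one_apply]; split_ifs <;> norm_num
    | succ m ih =>
      intro i j
      rw [pow_succ, Matrix.mul_apply]
      exact Finset.sum_nonneg fun l _ => mul_nonneg (ih i l) (hP l j)
  have hpowsum : ∀ (m : ℕ) i, ∑ j, (P ^ m) i j = 1 := by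
    intro m
    induction m with
    | zero => intro i; simp [Matrix.one_apply]
    | succ m ih =>
      intro i
      simp only [pow_succ, Matrix.mul_apply]
      rw [Finset.sum_comm]
      simp only [← Finset.mul_sum, hP1, mul_one, ih]
  have hpow1 : ∀ (m : ℕ) i j, (P ^ m) i j ≤ 1 := fun m i j => by
    rw [← hpowsum m i]
    exact Finset.single_le_sum (f := fun j => (P ^ m) i j) (fun l _ => hpow0 m i l)
      (Finset.mem_univ j)
  have hpowst : ∀ (m : ℕ) j, ∑ i, p i * (P ^ m) i j = p j := by
    intro m
    induction m with
    | zero => intro j; simp [Matrix.one_apply]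
    | succ m ih =>
      intro j
      simp only [pow_succ, Matrix.mul_apply, Finset.mul_sum]
      rw [Finset.sum_comm]
      simp only [← mul_assoc, ← Finset.sum_mul, ih, hst]
  let M : ℕ → Fin k → Fin k → ℝ := fun n i j =>
    (n : ℝ)⁻¹ * ∑ g ∈ Finset.range n, (P ^ (g + 1)) i j
  have hMmem : ∀ n, M n ∈ Set.pi univ fun _ : Fin k => Set.pi univ fun _ : Fin k => Icc (0 : ℝ) 1 := by
    intro n i _ j _
    refine ⟨mul_nonneg (by positivity) (Finset.sum_nonneg fun g _ => hpow0 _ i j), ?_⟩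
    have h1 : ∑ g ∈ Finset.range n, (P ^ (g + 1)) i j ≤ n := by
      simpa using Finset.sum_le_card_nsmul (Finset.range n) _ 1 fun g _ => hpow1 (g + 1) i j
    calc (n : ℝ)⁻¹ * _ ≤ (n : ℝ)⁻¹ * n := mul_le_mul_of_nonneg_left h1 (by positivity)
      _ ≤ 1 := inv_mul_le_one
  obtain ⟨Q, -, φ, hφ, hQ⟩ := (isCompact_univ_pi fun _ : Fin k =>
    isCompact_univ_pi fun _ : Fin k => isCompact_Icc (a := (0 : ℝ)) (b := 1)).tendsto_subseq hMmem
  have hQ' : ∀ i j, Tendsto (fun n => M (φ n) i j) atTop (nhds (Q i j)) := fun i j =>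
    tendsto_pi_nhds.1 (tendsto_pi_nhds.1 hQ i) j
  have hφinv : Tendsto (fun n => (φ n : ℝ)⁻¹) atTop (nhds 0) :=
    tendsto_inv_atTop_zero.comp (tendsto_natCast_atTop_atTop.comp hφ.tendsto_atTop)
  have hharm : ∀ i j, ∑ l, P i l * Q l j = Q i j := by
    intro i j
    have h1 : Tendsto (fun n => ∑ l, P i l * M (φ n) l j - M (φ n) i j) atTop
        (nhds (∑ l, P i l * Q l j - Q i j)) :=
      (tendsto_finsetSum _ fun l _ => (hQ' l j).const_mul _).sub (hQ' i j)
    have h2 : ∀ n, ∑ l, P i l * M n l j - M n i j = (n : ℝ)⁻¹ * ((P ^ (n + 1)) i j - P i j) := by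
      intro n
      have h3 : ∑ l, P i l * M n l j =
          (n : ℝ)⁻¹ * ∑ g ∈ Finset.range n, (P ^ (g + 1 + 1)) i j := by
        simp only [M, pow_succ' P (_ + 1), Matrix.mul_apply, mul_left_comm (P i _), ← Finset.mul_sum]
        rw [Finset.sum_comm]
        simp only [Finset.mul_sum]
      rw [h3, ← mul_sub, ← Finset.sum_sub_distrib,
        Finset.sum_range_sub (fun g => (P ^ (g + 1)) i j)]
      simp
    have h4 : Tendsto (fun n => ∑ l, P i l * M (φ n) l j - M (φ n) i j) atTop (nhds 0) := by
      simp only [h2]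
      refine squeeze_zero_norm (fun n => ?_) hφinv
      rw [norm_mul, Real.norm_of_nonneg (by positivity : (0 : ℝ) ≤ (φ n : ℝ)⁻¹)]
      refine mul_le_of_le_one_right (by positivity) ?_
      have a1 := hpow1 (φ n + 1) i j
      have a2 := hpow0 (φ n + 1) i j
      have a3 := hpow1 1 i j
      have a4 := hpow0 1 i j
      rw [pow_one] at a3 a4
      rw [Real.norm_eq_abs, abs_le]
      constructor <;> linarith
    exact sub_eq_zero.1 (tendsto_nhds_unique h1 h4)
  have hQst : ∀ j, ∑ i, p i * Q i j = p j := by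
    intro j
    have h1 : Tendsto (fun n => ∑ i, p i * M (φ n) i j) atTop (nhds (∑ i, p i * Q i j)) :=
      tendsto_finsetSum _ fun l _ => (hQ' l j).const_mul _
    refine tendsto_nhds_unique h1 (tendsto_const_nhds.congr' ?_)
    filter_upwards [eventually_gt_atTop 0] with n hn
    have hφn : (φ n : ℝ) ≠ 0 := by
      have := hφ.id_le n
      simp only [id] at this
      exact_mod_cast (by omega : φ n ≠ 0)
    simp only [M, mul_left_comm (p _), ← Finset.mul_sum]
    simp only [Finset.mul_sum]
    rw [Finset.sum_comm]
    simp only [← Finset.mul_sum, hpowst]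
    simp [hφn]
  refine ⟨φ, hφ, fun i j hi => ?_⟩
  have h1 : ∀ l, p l * Q l j = p l * Q i j := by
    intro l
    rcases (hp l).eq_or_lt with h | h
    · rw [← h]; simp
    · rw [eq_of_harmonic p P hp hP hP1 hst hconn (fun l => Q l j) (fun i => hharm i j) l i h hi]
  have h2 := hQst j
  simp only [h1, ← Finset.sum_mul, hp1, one_mul] at h2
  rw [← h2]
  exact hQ' i j

/-- The sets of configurations determined by finitely many coordinates. -/
def windowAlgebra (S : Type*) : Set (Set (ℤ → S)) :=
  {E | ∃ N : ℕ, ∀ x y : ℤ → S, (∀ i : ℤ, |i| ≤ N → x i = y i) → (x ∈ E ↔ y ∈ E)}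

lemma isSetAlgebra_windowAlgebra (S : Type*) : IsSetAlgebra (windowAlgebra S) where
  empty_mem := ⟨0, fun _ _ _ => Iff.rfl⟩
  compl_mem := by
    rintro s ⟨N, hN⟩
    exact ⟨N, fun x y h => not_congr (hN x y h)⟩
  union_mem := by
    rintro s t ⟨N, hN⟩ ⟨N', hN'⟩
    refine ⟨max N N', fun x y h => or_congr (hN x y fun i hi => h i ?_) (hN' x y fun i hi => h i ?_)⟩
    · exact hi.trans (by exact_mod_cast le_max_left _ _)
    · exact hi.trans (by exact_mod_cast le_max_right _ _)

lemma exists_finset_cyl {k : ℕ} {E : Set (ℤ → Fin k)} (hE : E ∈ windowAlgebra (Fin k)) :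
    ∃ (N : ℕ) (T : Finset (ℤ → Fin k)),
      (T : Set (ℤ → Fin k)).PairwiseDisjoint (fun z => cyl z (-N) (2 * N)) ∧
      E = ⋃ z ∈ T, cyl z (-N) (2 * N) := by
  classical
  obtain ⟨N, hN⟩ := hE
  refine ⟨N, ?_⟩
  have hcyl : ∀ z y : ℤ → Fin k, y ∈ cyl z (-N) (2 * N) ↔ ∀ i : ℤ, |i| ≤ N → y i = z i := by
    intro z y
    constructor
    · intro h i hi
      rw [abs_le] at hi
      have := h (i + N).toNat (by omega)
      rwa [show -(N : ℤ) + ((i + N).toNat : ℕ) = i by omega] at this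
    · intro h i hi
      exact h _ (abs_le.2 ⟨by omega, by omega⟩)
  rcases E.eq_empty_or_nonempty with rfl | ⟨x₀, -⟩
  · exact ⟨∅, by simp, by simp⟩
  let r : (ℤ → Fin k) → (ℤ → Fin k) := fun x i => if |i| ≤ N then x i else x₀ i
  have hfin : (range r).Finite := by
    let g : (Icc (-N : ℤ) N → Fin k) → (ℤ → Fin k) := fun w i =>
      if h : |i| ≤ N then w ⟨i, abs_le.1 h⟩ else x₀ i
    refine (finite_range g).subset ?_
    rintro _ ⟨x, rfl⟩
    refine ⟨fun i => x i, ?_⟩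
    funext i
    simp only [g, r]
    split_ifs <;> rfl
  have hr : ∀ x (i : ℤ), |i| ≤ N → r x i = x i := fun x i hi => if_pos hi
  refine ⟨(hfin.subset (inter_subset_right (s := E))).toFinset, ?_, ?_⟩
  · intro z hz z' hz' hne
    simp only [Set.Finite.coe_toFinset] at hz hz'
    obtain ⟨-, x, rfl⟩ := hz
    obtain ⟨-, x', rfl⟩ := hz'
    refine Set.disjoint_left.2 fun y hy hy' => hne ?_
    rw [hcyl] at hy hy'
    funext i
    by_cases hi : |i| ≤ N
    · rw [← hy i hi, ← hy' i hi]
    · simp [r, hi]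
  · ext y
    simp only [Set.Finite.mem_toFinset, mem_iUnion, exists_prop, mem_inter_iff, hcyl]
    constructor
    · intro hy
      exact ⟨r y, ⟨(hN y (r y) fun i hi => (hr y i hi).symm).1 hy, y, rfl⟩,
        fun i hi => (hr y i hi).symm⟩
    · rintro ⟨z, ⟨hz, -⟩, h⟩
      exact (hN y z h).2 hz

lemma measurableSet_of_mem_windowAlgebra {k : ℕ} {E : Set (ℤ → Fin k)}
    (hE : E ∈ windowAlgebra (Fin k)) : MeasurableSet E := by
  obtain ⟨N, T, -, rfl⟩ := exists_finset_cyl hE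
  exact Finset.measurableSet_biUnion _ fun z _ => (isClopen_cyl z _ _).isOpen.measurableSet

lemma generateFrom_windowAlgebra (k : ℕ) :
    (MeasurableSpace.pi : MeasurableSpace (ℤ → Fin k)) =
      MeasurableSpace.generateFrom (windowAlgebra (Fin k)) := by
  refine le_antisymm (iSup_le fun i => ?_)
    (MeasurableSpace.generateFrom_le fun E hE => measurableSet_of_mem_windowAlgebra hE)
  rintro _ ⟨s, -, rfl⟩
  refine MeasurableSpace.measurableSet_generateFrom ⟨i.natAbs, fun x y h => ?_⟩
  simp only [mem_preimage]
  rw [h i (by simp)]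

lemma measurable_shiftMap {k : ℕ} : Measurable (shiftMap : (ℤ → Fin k) → (ℤ → Fin k)) :=
  measurable_pi_lambda _ fun i => measurable_pi_apply (i + 1)

lemma shiftMap_iterate {S : Type*} (m : ℕ) (x : ℤ → S) (i : ℤ) :
    shiftMap^[m] x i = x (i + m) := by
  induction m generalizing x with
  | zero => simp
  | succ m ih =>
    rw [Function.iterate_succ_apply, ih]
    simp only [shiftMap]
    congr 1
    push_cast
    ring

lemma preimage_iterate_cyl {S : Type*} (m : ℕ) (z : ℤ → S) (a : ℤ) (n : ℕ) :
    shiftMap^[m] ⁻¹' cyl z a n = cyl (fun i => z (i - m)) (a + m) n := by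
  ext y
  refine forall₂_congr fun i _ => ?_
  rw [shiftMap_iterate, show a + m + (i : ℤ) = a + i + m by ring]
  simp only [add_sub_cancel_right]

/-- `μ` assigns to each window cylinder the weight given by the stationary Markov chain with
initial vector `p` and transition matrix `P`. -/
def IsMarkovMeasure {k : ℕ} (p : Fin k → ℝ) (P : Matrix (Fin k) (Fin k) ℝ)
    (μ : Measure (ℤ → Fin k)) : Prop :=
  ∀ (z : ℤ → Fin k) (a : ℤ) (n : ℕ),
    μ.real (cyl z a n) = p (z a) * ∏ i ∈ Finset.range n, P (z (a + i)) (z (a + i + 1))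

lemma IsMarkovMeasure.measurePreserving {k : ℕ} {p : Fin k → ℝ} {P : Matrix (Fin k) (Fin k) ℝ}
    {μ : Measure (ℤ → Fin k)} [IsProbabilityMeasure μ] (hμ : IsMarkovMeasure p P μ) :
    MeasurePreserving shiftMap μ μ := by
  refine ⟨measurable_shiftMap, ?_⟩
  have := Measure.isProbabilityMeasure_map (μ := μ)
    (measurable_shiftMap (k := k)).aemeasurable
  refine ext_of_generate_finite _ (generateFrom_windowAlgebra k)
    (isSetAlgebra_windowAlgebra _).isSetRing.isSetSemiring.isPiSystem ?_ (by simp)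
  intro E hE
  rw [Measure.map_apply measurable_shiftMap (measurableSet_of_mem_windowAlgebra hE)]
  obtain ⟨N, T, hT, rfl⟩ := exists_finset_cyl hE
  rw [preimage_iUnion₂, measure_biUnion_finset hT fun z _ =>
    (isClopen_cyl z _ _).isOpen.measurableSet, measure_biUnion_finset
      (fun z hz z' hz' h => (hT hz hz' h).preimage shiftMap) fun z _ =>
    measurable_shiftMap (isClopen_cyl z _ _).isOpen.measurableSet]
  refine Finset.sum_congr rfl fun z _ => ?_
  have h1 := preimage_iterate_cyl 1 z (-N) (2 * N)
  rw [Function.iterate_one] at h1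
  rw [← measureReal_eq_measureReal_iff, h1, hμ, hμ]
  push_cast
  rw [add_sub_cancel_right]
  congr 1
  refine Finset.prod_congr rfl fun i _ => ?_
  rw [show -(N : ℤ) + 1 + i - 1 = -N + i by ring, show -(N : ℤ) + 1 + i + 1 - 1 = -N + i + 1 by ring]

lemma IsMarkovMeasure.real_cyl_inter_cyl {k : ℕ} {p : Fin k → ℝ} {P : Matrix (Fin k) (Fin k) ℝ}
    {μ : Measure (ℤ → Fin k)} [IsProbabilityMeasure μ] (hμ : IsMarkovMeasure p P μ) (g : ℕ)
    (z z' : ℤ → Fin k) (a c : ℤ) (n m : ℕ) (hc : c = a + n + g + 1) :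
    μ.real (cyl z a n ∩ cyl z' c m) = μ.real (cyl z a n) * (P ^ (g + 1)) (z (a + n)) (z' c) *
      ∏ i ∈ Finset.range m, P (z' (c + i)) (z' (c + i + 1)) := by
  induction g generalizing z' c m with
  | zero =>
    simp only [Nat.cast_zero, add_zero] at hc
    obtain ⟨y, hy⟩ : ∃ y : ℤ → Fin k, y = fun i => if i ≤ a + n then z i else z' i := ⟨_, rfl⟩
    have hy1 : ∀ i, i ≤ a + n → y i = z i := fun i hi => by rw [hy]; exact if_pos hi
    have hy2 : ∀ i, a + n < i → y i = z' i := fun i hi => by rw [hy]; exact if_neg (by omega)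
    have hset : cyl z a n ∩ cyl z' c m = cyl y a (n + 1 + m) := by
      ext x
      constructor
      · rintro ⟨h1, h2⟩ i hi
        rcases Nat.lt_or_ge n i with h | h
        · have := h2 (i - n - 1) (by omega)
          rw [show c + ((i - n - 1 : ℕ) : ℤ) = a + i by omega] at this
          rw [this, hy2 _ (by omega)]
        · rw [h1 i h, hy1 _ (by omega)]
      · intro h
        refine ⟨fun i hi => ?_, fun i hi => ?_⟩
        · rw [h i (by omega), hy1 _ (by omega)]
        · have := h (n + 1 + i) (by omega)
          rw [show a + ((n + 1 + i : ℕ) : ℤ) = c + i by push_cast; omega] at this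
          rw [this, hy2 _ (by omega)]
    rw [hset, hμ, hμ, Finset.prod_range_add, Finset.prod_range_succ, hy1 a (by omega),
      hy1 (a + n) le_rfl, hy2 (a + n + 1) (by omega), ← hc, zero_add, pow_one]
    have e1 : ∏ i ∈ Finset.range n, P (y (a + i)) (y (a + i + 1)) =
        ∏ i ∈ Finset.range n, P (z (a + i)) (z (a + i + 1)) := by
      refine Finset.prod_congr rfl fun i hi => ?_
      rw [Finset.mem_range] at hi
      rw [hy1 _ (by omega), hy1 _ (by omega)]
    have e2 : ∏ i ∈ Finset.range m, P (y (a + ((n + 1 + i : ℕ) : ℤ)))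
          (y (a + ((n + 1 + i : ℕ) : ℤ) + 1)) =
        ∏ i ∈ Finset.range m, P (z' (c + i)) (z' (c + i + 1)) := by
      refine Finset.prod_congr rfl fun i _ => ?_
      rw [show a + ((n + 1 + i : ℕ) : ℤ) = c + i by push_cast; omega, hy2 _ (by omega),
        hy2 _ (by omega)]
    rw [e1, e2]
    ring
  | succ g ih =>
    let Z : Fin k → ℤ → Fin k := fun j => Function.update z' (c - 1) j
    have hZ1 : ∀ j, Z j (c - 1) = j := fun j => Function.update_self ..
    have hZ2 : ∀ j i, c ≤ i → Z j i = z' i := fun j i hi =>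
      Function.update_of_ne (by omega) ..
    have hmem : ∀ x j, x ∈ cyl (Z j) (c - 1) (m + 1) ↔ x (c - 1) = j ∧ x ∈ cyl z' c m := by
      intro x j
      constructor
      · intro h
        refine ⟨by simpa [hZ1] using h 0 (by omega), fun i hi => ?_⟩
        have := h (i + 1) (by omega)
        rw [show c - 1 + ((i + 1 : ℕ) : ℤ) = c + i by push_cast; ring] at this
        rw [this, hZ2 _ _ (by omega)]
      · rintro ⟨h1, h2⟩ i hi
        rcases i with _ | i
        · simpa [hZ1] using h1
        · rw [show c - 1 + ((i + 1 : ℕ) : ℤ) = c + i by push_cast; ring, h2 i (by omega),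
            hZ2 _ _ (by omega)]
    have hset : cyl z a n ∩ cyl z' c m =
        ⋃ j ∈ (Finset.univ : Finset (Fin k)), cyl z a n ∩ cyl (Z j) (c - 1) (m + 1) := by
      ext x
      simp [hmem]
    rw [hset, measureReal_biUnion_finset]
    · push_cast at hc
      rw [pow_succ, Matrix.mul_apply, Finset.mul_sum, Finset.sum_mul]
      refine Finset.sum_congr rfl fun j _ => ?_
      rw [ih (Z j) (c - 1) (m + 1) (by omega), Finset.prod_range_succ', hZ1]
      simp only [Nat.cast_zero, add_zero, sub_add_cancel, hZ1]
      rw [hZ2 _ c le_rfl]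
      have e2 : ∏ i ∈ Finset.range m, P (Z j (c - 1 + ((i + 1 : ℕ) : ℤ)))
            (Z j (c - 1 + ((i + 1 : ℕ) : ℤ) + 1)) =
          ∏ i ∈ Finset.range m, P (z' (c + i)) (z' (c + i + 1)) := by
        refine Finset.prod_congr rfl fun i _ => ?_
        rw [show c - 1 + ((i + 1 : ℕ) : ℤ) = c + i by push_cast; ring, hZ2 _ _ (by omega),
          hZ2 _ _ (by omega)]
      rw [e2]
      ring
    · intro j _ j' _ hjj'
      refine Set.disjoint_left.2 fun x hx hx' => hjj' ?_
      rw [← ((hmem x j).1 hx.2).1, ← ((hmem x j').1 hx'.2).1]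
    · intro j _
      exact ((isClopen_cyl _ _ _).inter (isClopen_cyl _ _ _)).isOpen.measurableSet

lemma IsMarkovMeasure.ergodic {k : ℕ} {p : Fin k → ℝ} {P : Matrix (Fin k) (Fin k) ℝ}
    {μ : Measure (ℤ → Fin k)} [IsProbabilityMeasure μ] (hμ : IsMarkovMeasure p P μ)
    (φ : ℕ → ℕ) (hφ : StrictMono φ) (hlim : ∀ i j, 0 < p i →
      Tendsto (fun n => (φ n : ℝ)⁻¹ * ∑ g ∈ Finset.range (φ n), (P ^ (g + 1)) i j) atTop
        (nhds (p j))) : Ergodic shiftMap μ := by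
  have hmp := hμ.measurePreserving
  refine ⟨hmp, ⟨fun E hE hinv => ?_⟩⟩
  have hinvm : ∀ m : ℕ, shiftMap^[m] ⁻¹' E = E := by
    intro m
    induction m with
    | zero => rfl
    | succ m ih => rw [Function.iterate_succ, preimage_comp, ih, hinv]
  obtain ⟨t, ht⟩ : ∃ t, t = μ.real E := ⟨_, rfl⟩
  have ht0 : 0 ≤ t := ht ▸ measureReal_nonneg
  have ht1 : t ≤ 1 := ht ▸ measureReal_le_one
  have key : ∀ ε : ℝ, 0 < ε → |t - t * t| ≤ 4 * ε := by
    intro ε hε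
    obtain ⟨C, hC, hCE⟩ := exists_measure_symmDiff_lt_of_generateFrom_isSetRing (μ := μ)
      (isSetAlgebra_windowAlgebra (Fin k)).isSetRing
      ⟨{univ}, countable_singleton _,
        singleton_subset_iff.2 (isSetAlgebra_windowAlgebra _).univ_mem, by simp⟩
      (generateFrom_windowAlgebra k) hE (ENNReal.ofReal_pos.2 hε)
    have hCm := measurableSet_of_mem_windowAlgebra hC
    have hCE' : μ.real (symmDiff C E) ≤ ε := by
      rw [Measure.real]
      exact ENNReal.toReal_le_of_le_ofReal hε.le hCE.le
    have hdiff : ∀ U V : Set (ℤ → Fin k), MeasurableSet U → MeasurableSet V →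
        |μ.real U - μ.real V| ≤ μ.real (symmDiff U V) := by
      intro U V hU hV
      exact abs_measureReal_sub_le_measureReal_symmDiff hU.nullMeasurableSet hV.nullMeasurableSet
    have hCt : |μ.real C - t| ≤ ε := ht ▸ (hdiff C E hCm hE).trans hCE'
    have hcor : ∀ m : ℕ, |μ.real (C ∩ shiftMap^[m] ⁻¹' C) - t| ≤ 2 * ε := by
      intro m
      have hm := hmp.iterate m
      rw [ht]
      refine (hdiff _ E (hCm.inter (hm.measurable hCm)) hE).trans ?_
      have hsub : symmDiff (C ∩ shiftMap^[m] ⁻¹' C) E ⊆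
          symmDiff C E ∪ shiftMap^[m] ⁻¹' (symmDiff C E) := by
        intro x hx
        have hx2 : shiftMap^[m] x ∈ E ↔ x ∈ E := by
          conv_rhs => rw [← hinvm m]
          rfl
        simp only [Set.mem_symmDiff, mem_inter_iff, mem_preimage, mem_union] at hx ⊢
        tauto
      refine (measureReal_mono hsub).trans ((measureReal_union_le _ _).trans ?_)
      rw [hm.measureReal_preimage (hCm.symmDiff hE).nullMeasurableSet]
      linarith
    obtain ⟨N, T, hT, rfl⟩ := exists_finset_cyl hC
    set C := ⋃ z ∈ T, cyl z (-N) (2 * N) with hCdef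
    have hCsum : μ.real C = ∑ z ∈ T, μ.real (cyl z (-N) (2 * N)) :=
      measureReal_biUnion_finset hT fun z _ => (isClopen_cyl z _ _).isOpen.measurableSet
    let pp : (ℤ → Fin k) → ℝ := fun z =>
      ∏ i ∈ Finset.range (2 * N), P (z (-N + i)) (z (-N + i + 1))
    have hpp : ∀ z, μ.real (cyl z (-N) (2 * N)) = p (z (-N)) * pp z := fun z => hμ z _ _
    have hcorsum : ∀ g : ℕ, μ.real (C ∩ shiftMap^[2 * N + g + 1] ⁻¹' C) =
        ∑ z ∈ T, ∑ z' ∈ T, μ.real (cyl z (-N) (2 * N)) * (P ^ (g + 1)) (z N) (z' (-N)) * pp z' := by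
      intro g
      have hset : C ∩ shiftMap^[2 * N + g + 1] ⁻¹' C = ⋃ q ∈ T ×ˢ T, cyl q.1 (-N) (2 * N) ∩
          shiftMap^[2 * N + g + 1] ⁻¹' cyl q.2 (-N) (2 * N) := by
        ext x
        simp only [hCdef, mem_inter_iff, mem_preimage, mem_iUnion, Finset.mem_product, exists_prop,
          Prod.exists]
        constructor
        · rintro ⟨⟨z, hz, h1⟩, z', hz', h2⟩
          exact ⟨z, z', ⟨hz, hz'⟩, h1, h2⟩
        · rintro ⟨z, z', ⟨hz, hz'⟩, h1, h2⟩
          exact ⟨⟨z, hz, h1⟩, z', hz', h2⟩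
      rw [hset, measureReal_biUnion_finset, Finset.sum_product]
      · refine Finset.sum_congr rfl fun z _ => Finset.sum_congr rfl fun z' _ => ?_
        rw [preimage_iterate_cyl, hμ.real_cyl_inter_cyl g _ _ _ _ _ _ (by push_cast; ring)]
        have e1 : (-N : ℤ) + ((2 * N : ℕ) : ℤ) = N := by push_cast; ring
        simp only [add_sub_cancel_right, e1]
        congr 1
        refine Finset.prod_congr rfl fun i _ => ?_
        congr 2 <;> ring
      · rintro ⟨z, z'⟩ hq ⟨y, y'⟩ hr hne
        simp only [Finset.coe_product, mem_prod, Finset.mem_coe] at hq hr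
        by_cases hzy : z = y
        · have hzy' : z' ≠ y' := fun h => hne (by rw [hzy, h])
          exact ((hT hq.2 hr.2 hzy').preimage _).mono inter_subset_right inter_subset_right
        · exact (hT hq.1 hr.1 hzy).mono inter_subset_left inter_subset_left
      · rintro ⟨z, z'⟩ -
        exact (isClopen_cyl _ _ _).isOpen.measurableSet.inter
          ((hmp.iterate _).measurable (isClopen_cyl _ _ _).isOpen.measurableSet)
    have hlimC : Tendsto (fun n => (φ n : ℝ)⁻¹ *
        ∑ g ∈ Finset.range (φ n), μ.real (C ∩ shiftMap^[2 * N + g + 1] ⁻¹' C)) atTop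
        (nhds (μ.real C * μ.real C)) := by
      have e1 : μ.real C * μ.real C = ∑ z ∈ T, ∑ z' ∈ T,
          μ.real (cyl z (-N) (2 * N)) * p (z' (-N)) * pp z' := by
        rw [hCsum, Finset.sum_mul_sum]
        refine Finset.sum_congr rfl fun z _ => Finset.sum_congr rfl fun z' _ => ?_
        rw [hpp z', mul_assoc]
      have e2 : ∀ n, (φ n : ℝ)⁻¹ *
          ∑ g ∈ Finset.range (φ n), μ.real (C ∩ shiftMap^[2 * N + g + 1] ⁻¹' C) =
          ∑ z ∈ T, ∑ z' ∈ T, μ.real (cyl z (-N) (2 * N)) * ((φ n : ℝ)⁻¹ *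
            ∑ g ∈ Finset.range (φ n), (P ^ (g + 1)) (z N) (z' (-N))) * pp z' := by
        intro n
        simp only [hcorsum]
        rw [Finset.sum_comm, Finset.mul_sum]
        refine Finset.sum_congr rfl fun z _ => ?_
        rw [Finset.sum_comm, Finset.mul_sum]
        refine Finset.sum_congr rfl fun z' _ => ?_
        simp only [Finset.mul_sum, Finset.sum_mul]
        refine Finset.sum_congr rfl fun g _ => ?_
        ring
      rw [e1]
      simp only [e2]
      refine tendsto_finsetSum _ fun z _ => tendsto_finsetSum _ fun z' _ => ?_
      refine Tendsto.mul_const _ ?_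
      have hz0 : μ.real (cyl z (-N) (2 * N)) ≤ p (z N) := by
        have h1 := hμ z N 0
        simp only [Finset.range_zero, Finset.prod_empty, mul_one] at h1
        rw [← h1]
        refine measureReal_mono fun x hx i hi => ?_
        have := hx (2 * N) le_rfl
        rw [show (-N : ℤ) + ((2 * N : ℕ) : ℤ) = N by push_cast; ring] at this
        obtain rfl : i = 0 := by omega
        simpa using this
      rcases (measureReal_nonneg (μ := μ) (s := cyl z (-N) (2 * N))).eq_or_lt with h | h
      · rw [← h]; simp
      · exact (hlim _ _ (h.trans_le hz0)).const_mul _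
    have hfin : |μ.real C * μ.real C - t| ≤ 2 * ε := by
      refine le_of_tendsto ((hlimC.sub_const t).abs) ?_
      filter_upwards [eventually_gt_atTop 0] with n hn
      have hφn : (0 : ℝ) < φ n := by
        have := hφ.id_le n
        simp only [id] at this
        exact_mod_cast (by omega : 0 < φ n)
      have e3 : (φ n : ℝ)⁻¹ * ∑ g ∈ Finset.range (φ n),
          μ.real (C ∩ shiftMap^[2 * N + g + 1] ⁻¹' C) - t = (φ n : ℝ)⁻¹ *
          ∑ g ∈ Finset.range (φ n), (μ.real (C ∩ shiftMap^[2 * N + g + 1] ⁻¹' C) - t) := by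
        rw [Finset.sum_sub_distrib, mul_sub]
        simp [hφn.ne']
      rw [e3, abs_mul, abs_of_pos (inv_pos.2 hφn), inv_mul_le_iff₀ hφn]
      refine (Finset.abs_sum_le_sum_abs _ _).trans ?_
      simpa using Finset.sum_le_card_nsmul (Finset.range (φ n)) _ (2 * ε)
        fun g _ => hcor (2 * N + g + 1)
    have hC0 : 0 ≤ μ.real C := measureReal_nonneg
    have hC1 : μ.real C ≤ 1 := measureReal_le_one
    have hprod : |μ.real C * μ.real C - t * t| ≤ 2 * ε := by
      rw [show μ.real C * μ.real C - t * t = (μ.real C + t) * (μ.real C - t) by ring, abs_mul,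
        abs_of_nonneg (by linarith)]
      exact mul_le_mul (by linarith) hCt (abs_nonneg _) (by norm_num)
    rw [abs_le] at *
    constructor <;> linarith [hfin.1, hfin.2, hprod.1, hprod.2]
  have ht2 : t - t * t = 0 := by
    by_contra hne
    have h1 := abs_pos.2 hne
    have h2 := key (|t - t * t| / 8) (by linarith)
    linarith
  rw [eventuallyConst_set']
  have ht3 : t * (1 - t) = 0 := by linarith
  rcases mul_eq_zero.1 ht3 with h | h
  · left
    rw [ae_eq_empty, ← measureReal_eq_zero_iff, ← ht, h]
  · right
    rw [ae_eq_univ, prob_compl_eq_zero_iff hE]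
    rw [ht, Measure.real] at h
    exact (ENNReal.toReal_eq_one_iff _).1 (by linarith)

lemma negMulLog_sum_le {ι : Type*} [Fintype ι] (p x : ι → ℝ) (hp : ∀ i, 0 ≤ p i)
    (hp1 : ∑ i, p i = 1) (hx : ∀ i, 0 ≤ x i) :
    ∑ i, p i * Real.negMulLog (x i) ≤ Real.negMulLog (∑ i, p i * x i) := by
  simpa only [smul_eq_mul] using Real.concaveOn_negMulLog.le_map_sum (t := Finset.univ)
    (fun i _ => hp i) hp1 (fun i _ => hx i)

lemma sum_wordWeight_mul_of_stationary {k : ℕ} {p : Fin k → ℝ} {P : Matrix (Fin k) (Fin k) ℝ}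
    (hst : ∀ j, ∑ i, p i * P i j = p j) (n : ℕ) (F : Fin k → ℝ) :
    ∑ w, wordWeight p P n w * F (w (Fin.last n)) = ∑ i, p i * F i := by
  induction n generalizing F with
  | zero =>
    rw [← (Equiv.funUnique (Fin 1) (Fin k)).symm.sum_comp]
    simp [wordWeight]
  | succ n ih =>
    rw [sum_words_snoc]
    simp only [wordWeight_snoc, Fin.snoc_last, mul_assoc, ← Finset.mul_sum]
    refine (ih fun a => ∑ j, P a j * F j).trans ?_
    simp only [Finset.mul_sum]
    rw [Finset.sum_comm]
    refine Finset.sum_congr rfl fun j _ => ?_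
    rw [← hst j, Finset.sum_mul]
    exact Finset.sum_congr rfl fun i _ => by ring

lemma sum_negMulLog_wordWeight {k : ℕ} {p : Fin k → ℝ} {P : Matrix (Fin k) (Fin k) ℝ}
    (hP1 : ∀ i, ∑ j, P i j = 1) (hst : ∀ j, ∑ i, p i * P i j = p j) (n : ℕ) :
    ∑ w, Real.negMulLog (wordWeight p P n w) =
      ∑ i, Real.negMulLog (p i) + n * ∑ i, p i * ∑ j, Real.negMulLog (P i j) := by
  induction n with
  | zero =>
    rw [← (Equiv.funUnique (Fin 1) (Fin k)).symm.sum_comp]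
    simp [wordWeight]
  | succ n ih =>
    rw [sum_words_snoc]
    simp only [wordWeight_snoc, Real.negMulLog_mul, Finset.sum_add_distrib, ← Finset.mul_sum,
      ← Finset.sum_mul, hP1, one_mul]
    rw [ih, sum_wordWeight_mul_of_stationary hst n (fun i => ∑ j, Real.negMulLog (P i j))]
    push_cast
    ring

lemma IsMarkovMeasure.blockH_eq {k : ℕ} {p : Fin k → ℝ} {P : Matrix (Fin k) (Fin k) ℝ}
    {μ : Measure (ℤ → Fin k)} (hμ : IsMarkovMeasure p P μ) (n : ℕ) :
    blockH μ (n + 1) = ∑ w, Real.negMulLog (wordWeight p P n w) := by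
  refine Finset.sum_congr rfl fun w _ => congrArg _ ?_
  let z : ℤ → Fin k := fun i => if h : i.toNat < n + 1 then w ⟨i.toNat, h⟩ else w 0
  have hz : ∀ i : Fin (n + 1), z (i : ℕ) = w i := fun i => by
    simp [z, Nat.le_of_lt_succ i.2]
  have hset : {x : ℤ → Fin k | ∀ i : Fin (n + 1), x ((i : ℕ) : ℤ) = w i} = cyl z 0 n := by
    ext x
    refine ⟨fun h i hi => ?_, fun h i => ?_⟩
    · have h1 := h ⟨i, Nat.lt_succ_of_le hi⟩
      have h2 := hz ⟨i, Nat.lt_succ_of_le hi⟩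
      simp only at h1 h2
      rw [zero_add, h1, h2]
    · have h1 := h i (Nat.le_of_lt_succ i.2)
      rwa [zero_add, hz] at h1
  rw [hset]
  refine (hμ z 0 n).trans ?_
  rw [wordWeight, Finset.prod_range]
  refine congrArg₂ (· * ·) (congrArg p (hz 0)) ?_
  refine Finset.prod_congr rfl fun i _ => ?_
  rw [← hz i.castSucc, ← hz i.succ]
  simp

lemma IsMarkovMeasure.mEntropy_eq {k : ℕ} {p : Fin k → ℝ} {P : Matrix (Fin k) (Fin k) ℝ}
    {μ : Measure (ℤ → Fin k)} (hμ : IsMarkovMeasure p P μ) (hp : ∀ i, 0 ≤ p i)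
    (hp1 : ∑ i, p i = 1) (hP : ∀ i j, 0 ≤ P i j) (hP1 : ∀ i, ∑ j, P i j = 1)
    (hst : ∀ j, ∑ i, p i * P i j = p j) :
    mEntropy μ = ∑ i, p i * ∑ j, Real.negMulLog (P i j) := by
  set h := ∑ i, p i * ∑ j, Real.negMulLog (P i j) with hh
  set H := ∑ i, Real.negMulLog (p i) with hH
  have hle : h ≤ H := by
    simp only [hh, hH, Finset.mul_sum]
    rw [Finset.sum_comm]
    refine Finset.sum_le_sum fun j _ => ?_
    have := negMulLog_sum_le p (fun i => P i j) hp hp1 fun i => hP i j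
    rwa [hst j] at this
  have hform : ∀ n : ℕ, blockH μ (n + 1) / (n + 1) = h + (H - h) / (n + 1) := by
    intro n
    have : (n : ℝ) + 1 ≠ 0 := by positivity
    rw [hμ.blockH_eq, sum_negMulLog_wordWeight hP1 hst]
    field_simp
    ring
  have hlim : Tendsto (fun n : ℕ => h + (H - h) / ((n : ℝ) + 1)) atTop (nhds h) := by
    simpa using ((tendsto_one_div_add_atTop_nhds_zero_nat (𝕜 := ℝ)).const_mul (H - h)).const_add h
      |>.congr fun n => by ring
  have hlb : ∀ n : ℕ, h ≤ h + (H - h) / ((n : ℝ) + 1) := fun n =>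
    le_add_of_nonneg_right (div_nonneg (by linarith) (by positivity))
  simp only [mEntropy, hform]
  refine le_antisymm (ge_of_tendsto' hlim fun n => ciInf_le ⟨h, ?_⟩ n) (le_ciInf hlb)
  rintro _ ⟨n, rfl⟩
  exact hlb n

/-- The entropy rate of the stationary Markov chain with edge weights `q`. -/
noncomputable def edgeEntropy {k : ℕ} (q : Fin k → Fin k → ℝ) : ℝ :=
  ∑ i, ∑ j, Real.negMulLog (q i j) - ∑ i, Real.negMulLog (∑ j, q i j)

lemma exists_ergodic_of_edgeWeights {k : ℕ} (A : Fin k → Fin k → ℕ) (q : Fin k → Fin k → ℝ)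
    (hq : ∀ i j, 0 ≤ q i j) (hq1 : ∑ i, ∑ j, q i j = 1)
    (hbal : ∀ i, ∑ j, q j i = ∑ j, q i j)
    (hconn : ∀ i j, 0 < ∑ l, q i l → 0 < ∑ l, q j l →
      Relation.ReflTransGen (fun a b => 0 < q a b) i j)
    (hA : ∀ i j, 0 < q i j → A i j = 1) :
    ∃ μ : Measure (ℤ → Fin k), IsProbabilityMeasure μ ∧ μ (SFT A) = 1 ∧
      Ergodic shiftMap μ ∧ mEntropy μ = edgeEntropy q := by
  classical
  set p : Fin k → ℝ := fun i => ∑ j, q i j with hpdef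
  let P : Matrix (Fin k) (Fin k) ℝ := fun i j =>
    if p i = 0 then (if i = j then 1 else 0) else q i j / p i
  have hp : ∀ i, 0 ≤ p i := fun i => Finset.sum_nonneg fun j _ => hq i j
  have hpq : ∀ i j, p i * P i j = q i j := by
    intro i j
    by_cases h : p i = 0
    · have : q i j = 0 := (Finset.sum_eq_zero_iff_of_nonneg fun j _ => hq i j).1 h j
        (Finset.mem_univ j)
      rw [h, this, zero_mul]
    · simp only [P, if_neg h]
      field_simp
  have hP : ∀ i j, 0 ≤ P i j := by
    intro i j
    simp only [P]
    split_ifs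
    · exact zero_le_one
    · exact le_rfl
    · exact div_nonneg (hq i j) (hp i)
  have hP1 : ∀ i, ∑ j, P i j = 1 := by
    intro i
    by_cases h : p i = 0
    · simp [P, h]
    · simp only [P, if_neg h, ← Finset.sum_div]
      exact div_self h
  have hst : ∀ j, ∑ i, p i * P i j = p j := fun j =>
    (Finset.sum_congr rfl fun i _ => hpq i j).trans (hbal j)
  obtain ⟨μ, hprob, hμ'⟩ := exists_measure_cyl p P hp hq1 hP hP1 hst
  have hμ : IsMarkovMeasure p P μ := hμ'
  obtain ⟨φ, hφ, hlim⟩ := exists_tendsto_cesaro p P hp hq1 hP hP1 hst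
    (by simpa only [hpq] using hconn)
  refine ⟨μ, hprob, ?_, hμ.ergodic φ hφ hlim, ?_⟩
  · have hsub : (SFT A)ᶜ ⊆ ⋃ (i : ℤ) (a : Fin k) (b : Fin k) (_ : A a b ≠ 1),
        cyl (fun m => if m = i then a else b) i 1 := by
      intro x hx
      simp only [SFT, mem_compl_iff, mem_ofPred_eq, not_forall] at hx
      obtain ⟨i, hi⟩ := hx
      simp only [mem_iUnion]
      refine ⟨i, x i, x (i + 1), hi, fun m hm => ?_⟩
      interval_cases m <;> simp
    have hnull : μ (SFT A)ᶜ = 0 := by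
      refine measure_mono_null hsub ?_
      simp only [measure_iUnion_null_iff]
      intro i a b hab
      have hqab : q a b = 0 := le_antisymm (not_lt.1 fun h => hab (hA a b h)) (hq a b)
      rw [← measureReal_eq_zero_iff, hμ]
      simp [hpq, hqab]
    have hmeas : MeasurableSet (SFT A) := by
      have : SFT A = ⋂ i : ℤ, (fun x : ℤ → Fin k => (x i, x (i + 1))) ⁻¹'
          {ab | A ab.1 ab.2 = 1} := by
        ext x; simp [SFT]
      rw [this]
      exact MeasurableSet.iInter fun i =>
        ((measurable_pi_apply i).prodMk (measurable_pi_apply (i + 1))) (Set.toFinite _).measurableSet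
    exact (prob_compl_eq_zero_iff hmeas).1 hnull
  · rw [hμ.mEntropy_eq hp hq1 hP hP1 hst, edgeEntropy, ← Finset.sum_sub_distrib]
    refine Finset.sum_congr rfl fun i _ => ?_
    have : ∑ j, Real.negMulLog (q i j) = Real.negMulLog (p i) +
        p i * ∑ j, Real.negMulLog (P i j) := by
      simp only [← hpq i, Real.negMulLog_mul, Finset.sum_add_distrib, ← Finset.sum_mul,
        ← Finset.mul_sum, hP1, one_mul]
    rw [this]
    ring

lemma matPow_cast {k : ℕ} (A : Fin k → Fin k → ℕ) (m : ℕ) (i j : Fin k) :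
    (matPow A m i j : ℝ) = ((Matrix.of fun i j => (A i j : ℝ)) ^ m) i j := by
  induction m generalizing j with
  | zero => simp [matPow, Matrix.one_apply]
  | succ m ih =>
    rw [pow_succ, Matrix.mul_apply, matPow]
    push_cast
    exact Finset.sum_congr rfl fun l _ => by rw [ih, Matrix.of_apply]

lemma reflTransGen_of_matPow_pos {k : ℕ} (A : Fin k → Fin k → ℕ)
    (h01 : ∀ i j, A i j = 0 ∨ A i j = 1) (m : ℕ) (i j : Fin k) (h : 0 < matPow A m i j) :
    Relation.ReflTransGen (fun a b => A a b = 1) i j := by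
  induction m generalizing j with
  | zero =>
    have : i = j := by
      by_contra hij
      simp [matPow, hij] at h
    exact this ▸ Relation.ReflTransGen.refl
  | succ m ih =>
    obtain ⟨l, -, hl⟩ := Finset.exists_ne_zero_of_sum_ne_zero h.ne'
    refine (ih l (Nat.pos_of_ne_zero (left_ne_zero_of_mul hl))).tail ?_
    exact (h01 l j).resolve_left (right_ne_zero_of_mul hl)

/-- Edge weights of the Parry measure. -/
lemma exists_edgeWeights_topEnt_le {k : ℕ} (hk : 1 ≤ k) (A : Fin k → Fin k → ℕ)
    (h01 : ∀ i j, A i j = 0 ∨ A i j = 1) (hirr : IrreducibleMat A) :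
    ∃ q : Fin k → Fin k → ℝ, (∀ i j, 0 ≤ q i j) ∧ ∑ i, ∑ j, q i j = 1 ∧
      (∀ i, ∑ j, q j i = ∑ j, q i j) ∧ (∀ i j, 0 < q i j ↔ A i j = 1) ∧
      topEnt A ≤ edgeEntropy q := by
  have : Nonempty (Fin k) := ⟨⟨0, hk⟩⟩
  set M : Matrix (Fin k) (Fin k) ℝ := Matrix.of fun i j => (A i j : ℝ) with hMdef
  have hM : ∀ i j, 0 ≤ M i j := fun i j => Nat.cast_nonneg _
  have hMirr : ∀ i j, ∃ m : ℕ, 1 ≤ m ∧ 0 < (M ^ m) i j := fun i j => by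
    obtain ⟨m, hm, hpos⟩ := hirr i j
    exact ⟨m, hm, by rw [← matPow_cast]; exact_mod_cast hpos⟩
  obtain ⟨c, r, hc, hr, hMr⟩ := exists_pos_eigenvector hk M hM hMirr
  obtain ⟨c', l, -, hl, hMl⟩ := exists_pos_eigenvector hk Mᵀ (fun i j => hM j i) fun i j => by
    obtain ⟨m, hm, hpos⟩ := hMirr j i
    exact ⟨m, hm, by rwa [← Matrix.transpose_pow]⟩
  have hr' : ∀ i, ∑ j, M i j * r j = c * r i := fun i => congrFun hMr i
  have hl' : ∀ j, ∑ i, M i j * l i = c' * l j := fun j => congrFun hMl j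
  set s : ℝ := ∑ i, l i * r i with hs
  have hs0 : 0 < s := Finset.sum_pos (fun i _ => mul_pos (hl i) (hr i)) Finset.univ_nonempty
  have hcc : c' = c := by
    have h1 : ∑ i, l i * ∑ j, M i j * r j = c * s := by
      rw [hs, Finset.mul_sum]
      exact Finset.sum_congr rfl fun i _ => by rw [hr']; ring
    have h2 : ∑ i, l i * ∑ j, M i j * r j = c' * s := by
      simp only [Finset.mul_sum, hs]
      rw [Finset.sum_comm]
      refine Finset.sum_congr rfl fun j _ => ?_
      rw [← mul_assoc, ← hl', Finset.sum_mul]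
      exact Finset.sum_congr rfl fun i _ => by ring
    exact mul_right_cancel₀ hs0.ne' (h2.symm.trans h1)
  subst hcc
  let q : Fin k → Fin k → ℝ := fun i j => l i * M i j * r j / (c' * s)
  have hrow : ∀ i, ∑ j, q i j = l i * r i / s := fun i => by
    simp only [q, ← Finset.sum_div, mul_assoc, ← Finset.mul_sum, hr']
    field_simp
  have hcol : ∀ i, ∑ j, q j i = l i * r i / s := fun i => by
    have : ∀ j, q j i = M j i * l j * (r i / (c' * s)) := fun j => by simp only [q]; ring
    simp only [this, ← Finset.sum_mul, hl']
    field_simp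
  have hpos : ∀ i j, 0 < q i j ↔ A i j = 1 := by
    intro i j
    rcases h01 i j with h | h
    · simp [q, hMdef, h]
    · simp only [q, hMdef, h, Matrix.of_apply, Nat.cast_one, mul_one, iff_true]
      exact div_pos (mul_pos (hl i) (hr j)) (mul_pos hc hs0)
  have hnn : ∀ i j, 0 ≤ q i j := fun i j =>
    div_nonneg (mul_nonneg (mul_nonneg (hl i).le (hM i j)) (hr j).le) (mul_pos hc hs0).le
  have hsum : ∑ i, ∑ j, q i j = 1 := by
    simp only [hrow, ← Finset.sum_div]
    exact div_self hs0.ne'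
  refine ⟨q, hnn, hsum, fun i => (hcol i).trans (hrow i).symm, hpos,
    (topEnt_le_log hk A h01 c' hc r hr hMr).trans (le_of_eq ?_)⟩
  have hterm : ∀ i j, Real.negMulLog (q i j) =
      q i j * (Real.log c' + Real.log s) - q i j * Real.log (l i) - q i j * Real.log (r j) := by
    intro i j
    rcases h01 i j with h | h
    · have : q i j = 0 := by simp [q, hMdef, h]
      simp [this]
    · have : Real.log (q i j) =
          Real.log (l i) + Real.log (r j) - (Real.log c' + Real.log s) := by
        simp only [q, hMdef, h, Matrix.of_apply, Nat.cast_one, mul_one]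
        rw [Real.log_div (mul_pos (hl i) (hr j)).ne' (mul_pos hc hs0).ne',
          Real.log_mul (hl i).ne' (hr j).ne', Real.log_mul hc.ne' hs0.ne']
      rw [Real.negMulLog, this]
      ring
  have hterm2 : ∀ i, Real.negMulLog (l i * r i / s) =
      l i * r i / s * Real.log s - l i * r i / s * Real.log (l i) -
        l i * r i / s * Real.log (r i) := by
    intro i
    rw [Real.negMulLog, Real.log_div (mul_pos (hl i) (hr i)).ne' hs0.ne',
      Real.log_mul (hl i).ne' (hr i).ne']
    ring
  have e1 : ∑ i, ∑ j, q i j * Real.log (l i) = ∑ i, l i * r i / s * Real.log (l i) := by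
    simp only [← Finset.sum_mul, hrow]
  have e2 : ∑ i, ∑ j, q i j * Real.log (r j) = ∑ i, l i * r i / s * Real.log (r i) := by
    rw [Finset.sum_comm]
    simp only [← Finset.sum_mul, hcol]
  have e3 : ∑ i, l i * r i / s = 1 := by rw [← hsum]; simp only [hrow]
  simp only [edgeEntropy, hrow, hterm, hterm2, Finset.sum_sub_distrib, e1, e2]
  simp only [← Finset.sum_mul, hrow, e3]
  ring

/-- The uniform edge weights of a periodic orbit. -/
lemma exists_edgeWeights_entropy_zero {k : ℕ} (hk : 1 ≤ k) (A : Fin k → Fin k → ℕ)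
    (f : Fin k → Fin k) (hf : ∀ i, A i (f i) = 1) :
    ∃ q : Fin k → Fin k → ℝ, (∀ i j, 0 ≤ q i j) ∧ ∑ i, ∑ j, q i j = 1 ∧
      (∀ i, ∑ j, q j i = ∑ j, q i j) ∧ (∀ i j, 0 < q i j → A i j = 1) ∧
      (∀ i j, 0 < ∑ l, q i l → 0 < ∑ l, q j l →
        Relation.ReflTransGen (fun a b => 0 < q a b) i j) ∧
      edgeEntropy q = 0 := by
  classical
  have : Nonempty (Fin k) := ⟨⟨0, hk⟩⟩
  obtain ⟨x, hx⟩ : ∃ x, x ∈ Function.periodicPts f := by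
    obtain ⟨m, n, hne, heq⟩ := Finite.exists_ne_map_eq_of_infinite
      fun n : ℕ => f^[n] (Classical.arbitrary (Fin k))
    wlog hmn : m < n generalizing m n
    · exact this n m hne.symm heq.symm (by omega)
    refine ⟨f^[m] (Classical.arbitrary (Fin k)), n - m, by omega, ?_⟩
    rw [Function.IsPeriodicPt, Function.IsFixedPt, ← Function.iterate_add_apply,
      Nat.sub_add_cancel hmn.le]
    exact heq.symm
  let O : Finset (Fin k) := Finset.univ.filter fun i => ∃ n : ℕ, f^[n] x = i
  have hO : ∀ i, i ∈ O ↔ ∃ n : ℕ, f^[n] x = i := fun i => by simp [O]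
  have hfO : ∀ i ∈ O, f i ∈ O := by
    intro i hi
    obtain ⟨n, rfl⟩ := (hO i).1 hi
    exact (hO _).2 ⟨n + 1, Function.iterate_succ_apply' f n x⟩
  have hsurj : ∀ i ∈ O, ∃ j ∈ O, f j = i := by
    intro i hi
    obtain ⟨n, rfl⟩ := (hO i).1 hi
    obtain ⟨m, hm, hper⟩ := hx
    refine ⟨f^[n + m - 1] x, (hO _).2 ⟨_, rfl⟩, ?_⟩
    rw [← Function.iterate_succ_apply' f, Nat.succ_eq_add_one,
      Nat.sub_add_cancel (by omega), Function.iterate_add_apply, hper]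
  have hinj : Set.InjOn f O := by
    have himg : O.image f = O := by
      refine (Finset.Subset.antisymm (Finset.image_subset_iff.2 hfO) fun i hi => ?_)
      obtain ⟨j, hj, rfl⟩ := hsurj i hi
      exact Finset.mem_image_of_mem f hj
    exact Finset.card_image_iff.1 (by rw [himg])
  have hxO : x ∈ O := (hO x).2 ⟨0, rfl⟩
  have hcard : (0 : ℝ) < O.card := Nat.cast_pos.2 (Finset.card_pos.2 ⟨x, hxO⟩)
  let u : ℝ := (O.card : ℝ)⁻¹
  have hu : 0 < u := inv_pos.2 hcard
  let q : Fin k → Fin k → ℝ := fun i j => if i ∈ O ∧ f i = j then u else 0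
  have hrow : ∀ i, ∑ j, q i j = if i ∈ O then u else 0 := fun i => by
    by_cases h : i ∈ O <;> simp [q, h]
  have hcol : ∀ i, ∑ j, q j i = if i ∈ O then u else 0 := fun i => by
    split_ifs with h
    · obtain ⟨j, hj, rfl⟩ := hsurj i h
      rw [Finset.sum_eq_single j]
      · simp [q, hj]
      · intro b _ hb
        exact if_neg fun hb' => hb (hinj hb'.1 hj hb'.2)
      · simp
    · refine Finset.sum_eq_zero fun j _ => if_neg ?_
      rintro ⟨hj, rfl⟩
      exact h (hfO j hj)
  have hqpos : ∀ i j, 0 < q i j ↔ i ∈ O ∧ f i = j := fun i j => by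
    simp only [q]
    split_ifs with h <;> simp [h, hu]
  have hreach : ∀ i ∈ O, ∀ n : ℕ, Relation.ReflTransGen (fun a b => 0 < q a b) i (f^[n] i) := by
    intro i hi n
    induction n generalizing i with
    | zero => exact Relation.ReflTransGen.refl
    | succ n ih => exact Relation.ReflTransGen.head ((hqpos i (f i)).2 ⟨hi, rfl⟩) (ih _ (hfO i hi))
  refine ⟨q, fun i j => ?_, ?_, fun i => (hcol i).trans (hrow i).symm, fun i j h => ?_,
    fun i j hi hj => ?_, ?_⟩
  · simp only [q]
    split_ifs
    · exact hu.le
    · exact le_rfl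
  · simp only [hrow]
    rw [Finset.sum_ite_mem, Finset.univ_inter, Finset.sum_const, nsmul_eq_mul]
    exact mul_inv_cancel₀ hcard.ne'
  · rw [← ((hqpos i j).1 h).2]
    exact hf i
  · have hi' : i ∈ O := by by_contra h; simp [hrow, h] at hi
    have hj' : j ∈ O := by by_contra h; simp [hrow, h] at hj
    obtain ⟨n, rfl⟩ := (hO i).1 hi'
    obtain ⟨m, rfl⟩ := (hO j).1 hj'
    obtain ⟨t, ht, hper⟩ := hx
    have h1 := hreach _ hi' (m + (t * (n + 1) - n))
    have h2 : t * (n + 1) ≥ n + 1 := Nat.le_mul_of_pos_left _ ht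
    rwa [← Function.iterate_add_apply,
      show m + (t * (n + 1) - n) + n = m + t * (n + 1) by omega, Function.iterate_add_apply,
      (hper.mul_const (n + 1) : f^[t * (n + 1)] x = x)] at h1
  · rw [edgeEntropy, ← Finset.sum_sub_distrib]
    refine Finset.sum_eq_zero fun i _ => ?_
    rw [hrow, sub_eq_zero]
    by_cases h : i ∈ O
    · rw [if_pos h, Finset.sum_eq_single (f i)]
      · simp [q, h]
      · intro b _ hb
        simp [q, Ne.symm hb]
      · simp
    · simp [q, h]

lemma continuous_edgeEntropy {k : ℕ} : Continuous (edgeEntropy : (Fin k → Fin k → ℝ) → ℝ) := by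
  have := Real.continuous_negMulLog
  unfold edgeEntropy
  fun_prop

/-- For an irreducible `k × k` 0-1 matrix `A` and every real `h`
with `0 ≤ h ≤ h_top(σ, Σ_A)`, there is an ergodic shift-invariant Borel probability
measure `μ` carried by `Σ_A` with `h_μ(σ) = h`. -/
theorem stmt3 {k : ℕ} (hk : 1 ≤ k) (A : Fin k → Fin k → ℕ)
    (h01 : ∀ i j, A i j = 0 ∨ A i j = 1) (hirr : IrreducibleMat A)
    (h : ℝ) (h0 : 0 ≤ h) (hle : h ≤ topEnt A) :
    ∃ μ : Measure (ℤ → Fin k), IsProbabilityMeasure μ ∧ μ (SFT A) = 1 ∧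
      Ergodic shiftMap μ ∧ mEntropy μ = h := by
  have hout : ∀ i, ∃ j, A i j = 1 := by
    intro i
    obtain ⟨m, hm, hpos⟩ := hirr i i
    have hgen : Relation.TransGen (fun a b => A a b = 1) i i := by
      obtain ⟨m, rfl⟩ := Nat.exists_eq_add_of_le' hm
      obtain ⟨l, -, hl⟩ := Finset.exists_ne_zero_of_sum_ne_zero hpos.ne'
      exact Relation.TransGen.tail' (reflTransGen_of_matPow_pos A h01 m i l
        (Nat.pos_of_ne_zero (left_ne_zero_of_mul hl)))
        ((h01 l i).resolve_left (right_ne_zero_of_mul hl))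
    obtain ⟨j, hj, -⟩ := Relation.TransGen.head'_iff.1 hgen
    exact ⟨j, hj⟩
  choose f hf using hout
  obtain ⟨q₀, hq₀, hsum₀, hbal₀, hA₀, hconn₀, hent₀⟩ :=
    exists_edgeWeights_entropy_zero hk A f hf
  obtain ⟨q₁, hq₁, hsum₁, hbal₁, hA₁, hent₁⟩ := exists_edgeWeights_topEnt_le hk A h01 hirr
  let q : ℝ → Fin k → Fin k → ℝ := fun t i j => (1 - t) * q₀ i j + t * q₁ i j
  have hqc : Continuous fun t => edgeEntropy (q t) :=
    continuous_edgeEntropy.comp (by fun_prop)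
  obtain ⟨t, ⟨ht0, ht1⟩, ht⟩ := intermediate_value_Icc zero_le_one hqc.continuousOn
    (show h ∈ Icc (edgeEntropy (q 0)) (edgeEntropy (q 1)) by
      simp only [q, sub_zero, one_mul, zero_mul, add_zero, sub_self, zero_add]
      exact ⟨hent₀.trans_le h0, hle.trans hent₁⟩)
  simp only at ht
  rcases ht0.eq_or_lt with rfl | htpos
  · have hq0 : q 0 = q₀ := by
      ext i j
      simp [q]
    rw [← ht, hq0]
    exact exists_ergodic_of_edgeWeights A q₀ hq₀ hsum₀ hbal₀ hconn₀ hA₀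
  · rw [← ht]
    have hpos : ∀ i j, A i j = 1 → 0 < q t i j := fun i j hij =>
      add_pos_of_nonneg_of_pos (mul_nonneg (by linarith) (hq₀ i j))
        (mul_pos htpos ((hA₁ i j).2 hij))
    refine exists_ergodic_of_edgeWeights A (q t)
      (fun i j => add_nonneg (mul_nonneg (by linarith) (hq₀ i j)) (mul_nonneg ht0 (hq₁ i j)))
      ?_ (fun i => ?_) (fun i j _ _ => ?_) fun i j hij => ?_
    · simp only [q, Finset.sum_add_distrib, ← Finset.mul_sum, hsum₀, hsum₁]
      ring
    · simp only [q, Finset.sum_add_distrib, ← Finset.mul_sum, hbal₀, hbal₁]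
    · obtain ⟨m, -, hm⟩ := hirr i j
      exact Relation.ReflTransGen.mono hpos _ _ (reflTransGen_of_matPow_pos A h01 m i j hm)
    · by_contra hne
      have h₀ : q₀ i j = 0 := le_antisymm (not_lt.1 fun hlt => hne (hA₀ i j hlt)) (hq₀ i j)
      have h₁ : q₁ i j = 0 := le_antisymm (not_lt.1 fun hlt => hne ((hA₁ i j).1 hlt)) (hq₁ i j)
      simp [q, h₀, h₁] at hij
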